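/- arXiv:1512.03215 — 4 statements merged into one kernel-verified Lean document; each statement's English description precedes it below -/
import Mathlib

section
/- For all vertices v, w of the hyperbolic filling X of (Z,d) there exists a vertex x ∈ V such that B_v ∪ B_w ⊆ B_x and the radius 2 s^{−ℓ(x)} of B_x satisfies 2 s^{−ℓ(x)} ≤ 2s · diam(B_v ∪ B_w). -/
open Metric

/-- Vertices of the hyperbolic filling: pairs `(k, p)` with `p ∈ P k`. -/
def HypVert {Z : Type} (P : ℕ → Set Z) : Type := {x : ℕ × Z // x.2 ∈ P x.1}

/-- The ball `B_v = B(p, 2 s^{-k})` associated to a vertex `v = (k, p)`. -/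
noncomputable def hypBall {Z : Type} [MetricSpace Z] (s : ℝ) {P : ℕ → Set Z}
    (v : HypVert P) : Set Z :=
  ball v.val.2 (2 * s ^ (-(v.val.1 : ℝ)))

/-- The hyperbolic filling graph: distinct vertices are adjacent iff their levels
differ by at most one and the closures of their balls intersect. -/
noncomputable def hypGraph {Z : Type} [MetricSpace Z] (s : ℝ) (P : ℕ → Set Z) :
    SimpleGraph (HypVert P) :=
  SimpleGraph.fromRel fun v w =>
    |(v.val.1 : ℤ) - (w.val.1 : ℤ)| ≤ 1 ∧
      (closure (hypBall s v) ∩ closure (hypBall s w)).Nonempty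

/-- In a connected metric space of positive diameter, a nonempty bounded open set has positive
diameter. -/
theorem diam_pos_of_isOpen {Z : Type*} [MetricSpace Z] [PreconnectedSpace Z]
    (hd0 : 0 < diam (Set.univ : Set Z)) {E : Set Z} (hE : IsOpen E) (hne : E.Nonempty)
    (hb : Bornology.IsBounded E) : 0 < diam E := by
  by_contra! h
  have hsub : E.Subsingleton := fun x hx y hy =>
    dist_le_zero.1 ((dist_le_diam_of_mem hb hx hy).trans h)
  have huniv : E = Set.univ := IsClopen.eq_univ ⟨hsub.isClosed, hE⟩ hne
  exact (huniv ▸ h).not_gt hd0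

/-- For all vertices `v, w` of the hyperbolic filling there is a vertex `x` with
`B_v ∪ B_w ⊆ B_x` whose radius `2 s^{-ℓ(x)}` is at most `2 s · diam (B_v ∪ B_w)`. -/
theorem stmt1 {Z : Type} [MetricSpace Z] [CompactSpace Z] [ConnectedSpace Z]
    (hd0 : 0 < diam (Set.univ : Set Z)) (hd1 : diam (Set.univ : Set Z) < 1)
    (s : ℝ) (hs : 1 < s) (P : ℕ → Set Z)
    (hsep : ∀ k : ℕ, ∀ p ∈ P k, ∀ q ∈ P k, p ≠ q → s ^ (-(k : ℝ)) ≤ dist p q)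
    (hmax : ∀ (k : ℕ) (z : Z), ∃ p ∈ P k, dist z p < s ^ (-(k : ℝ)))
    (v w : HypVert P) :
    ∃ x : HypVert P,
      hypBall s v ∪ hypBall s w ⊆ hypBall s x ∧
        2 * s ^ (-(x.val.1 : ℝ)) ≤ 2 * s * diam (hypBall s v ∪ hypBall s w) := by
  set E := hypBall s v ∪ hypBall s w
  have hs0 : 0 < s := one_pos.trans hs
  have hrpow : ∀ k : ℕ, s ^ (-(k : ℝ)) = s⁻¹ ^ k := fun k => by
    rw [Real.rpow_neg hs0.le, Real.rpow_natCast, inv_pow]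
  have hcenter : v.val.2 ∈ E :=
    Or.inl (mem_ball_self (mul_pos two_pos (Real.rpow_pos_of_pos hs0 _)))
  have hbdd : ∀ A : Set Z, Bornology.IsBounded A := fun A =>
    isCompact_univ.isBounded.subset (Set.subset_univ A)
  have hpos : 0 < diam E :=
    diam_pos_of_isOpen hd0 (isOpen_ball.union isOpen_ball) ⟨_, hcenter⟩ (hbdd E)
  have hle : diam E ≤ 1 := (diam_mono (Set.subset_univ E) (hbdd _)).trans hd1.le
  obtain ⟨k, hlt, hge⟩ :=
    exists_nat_pow_near_of_lt_one hpos hle (inv_pos.2 hs0) (inv_lt_one_of_one_lt₀ hs)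
  obtain ⟨p, hp, hdist⟩ := hmax k v.val.2
  refine ⟨⟨(k, p), hp⟩, fun y hy => ?_, ?_⟩
  · have h₁ := dist_le_diam_of_mem (hbdd E) hy hcenter
    have h₂ := dist_triangle y v.val.2 p
    rw [← hrpow] at hge
    simp only [hypBall, mem_ball]
    linarith
  · have h : s * s⁻¹ ^ (k + 1) = s⁻¹ ^ k := by
      rw [pow_succ', mul_inv_cancel_left₀ hs0.ne']
    simp only [hrpow]
    linarith [mul_lt_mul_of_pos_left hlt hs0]
end

section
/- The hyperbolic filling X of (Z,d) is Gromov hyperbolic: there exists δ ≥ 0, depending only on s, such that for all vertices u, v, w of X one has (u,w) ≥ min((u,v), (v,w)) − δ, where (·,·) denotes the Gromov product based at the root vertex O. -/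
open Metric

/-- The Gromov product `(v,w) = (|O-v| + |O-w| - |v-w|)/2` with respect to the
graph distance of the hyperbolic filling, based at the vertex `O`. -/
noncomputable def gromovProd {Z : Type} [MetricSpace Z] (s : ℝ) (P : ℕ → Set Z)
    (O v w : HypVert P) : ℝ :=
  (((hypGraph s P).dist O v : ℝ) + ((hypGraph s P).dist O w : ℝ)
    - ((hypGraph s P).dist v w : ℝ)) / 2

section HypGraph

variable {Z : Type} [MetricSpace Z] {s : ℝ} {P : ℕ → Set Z}

theorem rpow_neg_natCast_eq (s : ℝ) (hs : 1 < s) (k : ℕ) : s ^ (-(k : ℝ)) = s⁻¹ ^ k := by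
  rw [Real.rpow_neg (by linarith), Real.rpow_natCast, inv_pow]

theorem pow_mul_inv_pow_le {s : ℝ} (hs : 1 < s) {m k l : ℕ} (h : m + k ≤ l) :
    s ^ m * s⁻¹ ^ l ≤ s⁻¹ ^ k := by
  have h0 : 0 < s := by linarith
  rw [inv_pow, inv_pow, ← div_eq_mul_inv, div_le_iff₀ (by positivity), ← div_eq_inv_mul,
    le_div_iff₀ (by positivity), ← pow_add]
  exact pow_le_pow_right₀ hs.le h

theorem hypGraph_adj_iff {v w : HypVert P} :
    (hypGraph s P).Adj v w ↔ v ≠ w ∧ |(v.val.1 : ℤ) - (w.val.1 : ℤ)| ≤ 1 ∧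
      (closure (hypBall s v) ∩ closure (hypBall s w)).Nonempty := by
  rw [hypGraph, SimpleGraph.fromRel_adj, abs_sub_comm (w.val.1 : ℤ), Set.inter_comm
    (closure (hypBall s w)), or_self]

theorem hypGraph_level_le_of_walk {v w : HypVert P} (p : (hypGraph s P).Walk v w) :
    w.val.1 ≤ v.val.1 + p.length := by
  induction p with
  | nil => simp
  | cons h p ih =>
    have := abs_le.1 (hypGraph_adj_iff.1 h).2.1
    rw [SimpleGraph.Walk.length_cons]
    omega

theorem dist_center_le_of_adj (hs : 1 < s) {v w : HypVert P} (h : (hypGraph s P).Adj v w) :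
    dist v.val.2 w.val.2 ≤ 2 * s⁻¹ ^ v.val.1 + 2 * s⁻¹ ^ w.val.1 := by
  obtain ⟨z, hv, hw⟩ := (hypGraph_adj_iff.1 h).2.2
  have hv' := closure_ball_subset_closedBall hv
  have hw' := closure_ball_subset_closedBall hw
  rw [mem_closedBall, rpow_neg_natCast_eq s hs] at hv' hw'
  linarith [dist_triangle_left v.val.2 w.val.2 z]

/-- Along a walk of length `m` starting at level `l`, the centers move by at most a multiple of
`s ^ (m - l)`. -/
theorem dist_center_le_of_walk (hs : 1 < s) {v w : HypVert P} (p : (hypGraph s P).Walk v w) :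
    dist v.val.2 w.val.2 ≤ 2 * (1 + s) / (s - 1) * (s ^ p.length - 1) * s⁻¹ ^ v.val.1 := by
  have h0 : 0 < s := by linarith
  have h1 : 0 < s - 1 := by linarith
  induction p with
  | nil => simp
  | @cons v x w h p ih =>
    have hd := dist_center_le_of_adj hs h
    have hl := abs_le.1 (hypGraph_adj_iff.1 h).2.1
    have hx : s⁻¹ ^ x.val.1 ≤ s * s⁻¹ ^ v.val.1 := by
      have hle : s⁻¹ ^ (x.val.1 + 1) ≤ s⁻¹ ^ v.val.1 :=
        pow_le_pow_of_le_one (by positivity) (inv_le_one_of_one_le₀ hs.le) (by omega)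
      calc s⁻¹ ^ x.val.1 = s * s⁻¹ ^ (x.val.1 + 1) := by rw [pow_succ]; field_simp
        _ ≤ _ := by gcongr
    have hp : 0 ≤ s ^ p.length - 1 := sub_nonneg.2 (one_le_pow₀ hs.le)
    calc dist v.val.2 w.val.2 ≤ dist v.val.2 x.val.2 + dist x.val.2 w.val.2 := dist_triangle _ _ _
      _ ≤ (2 * s⁻¹ ^ v.val.1 + 2 * (s * s⁻¹ ^ v.val.1)) +
          2 * (1 + s) / (s - 1) * (s ^ p.length - 1) * (s * s⁻¹ ^ v.val.1) := by
        refine add_le_add (hd.trans (by linarith)) (ih.trans ?_)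
        gcongr
      _ = _ := by
        rw [SimpleGraph.Walk.length_cons]
        field_simp
        ring

theorem dist_center_le_of_walk_length (hs : 1 < s) {v w : HypVert P}
    (p : (hypGraph s P).Walk v w) {k : ℕ} (h : p.length + k ≤ v.val.1) :
    dist v.val.2 w.val.2 ≤ 2 * (1 + s) / (s - 1) * s⁻¹ ^ k := by
  have h0 : 0 < s := by linarith
  have h1 : 0 < s - 1 := by linarith
  calc _ ≤ _ := dist_center_le_of_walk hs p
    _ ≤ 2 * (1 + s) / (s - 1) * s ^ p.length * s⁻¹ ^ v.val.1 := by gcongr; linarith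
    _ = 2 * (1 + s) / (s - 1) * (s ^ p.length * s⁻¹ ^ v.val.1) := by ring
    _ ≤ _ := by gcongr; exact pow_mul_inv_pow_le hs h

theorem dist_center_le_of_two_mul_le (hs : 1 < s) (hconn : (hypGraph s P).Preconnected)
    {v w : HypVert P} {k : ℕ} (h : 2 * k + (hypGraph s P).dist v w ≤ v.val.1 + w.val.1) :
    dist v.val.2 w.val.2 ≤ 4 * (1 + s) / (s - 1) * s⁻¹ ^ k := by
  obtain ⟨p, hp⟩ := (hconn v w).exists_walk_length_eq_dist
  have hvw := hypGraph_level_le_of_walk p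
  have hwv := hypGraph_level_le_of_walk p.reverse
  rw [SimpleGraph.Walk.length_reverse] at hwv
  have h1 := dist_center_le_of_walk_length hs (p.take (v.val.1 - k)) (k := k) (by
    rw [SimpleGraph.Walk.take_length]; omega)
  have h2 := dist_center_le_of_walk_length hs (p.drop (v.val.1 - k)).reverse (k := k) (by
    rw [SimpleGraph.Walk.length_reverse, SimpleGraph.Walk.drop_length]; omega)
  rw [dist_comm] at h2
  have heq : 4 * (1 + s) / (s - 1) * s⁻¹ ^ k = 2 * (1 + s) / (s - 1) * s⁻¹ ^ k +
    2 * (1 + s) / (s - 1) * s⁻¹ ^ k := by ring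
  rw [heq]
  exact (dist_triangle _ _ _).trans (add_le_add h1 h2)

theorem exists_walk_length_le_one {x v : HypVert P} {z : Z}
    (hx : z ∈ hypBall s x) (hv : z ∈ hypBall s v) (h : |(x.val.1 : ℤ) - (v.val.1 : ℤ)| ≤ 1) :
    ∃ p : (hypGraph s P).Walk x v, p.length ≤ 1 := by
  by_cases hxv : x = v
  · subst hxv
    exact ⟨.nil, by simp⟩
  · exact ⟨(hypGraph_adj_iff.2 ⟨hxv, h, z, subset_closure hx, subset_closure hv⟩).toWalk, by simp⟩

theorem exists_hypVert_dist_lt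
    (hP : ∀ (k : ℕ) (z : Z), ∃ p ∈ P k, dist z p < s ^ (-(k : ℝ))) (k : ℕ) (z : Z) :
    ∃ y : HypVert P, y.val.1 = k ∧ dist z y.val.2 < s ^ (-(k : ℝ)) := by
  obtain ⟨y, hy, hd⟩ := hP k z
  exact ⟨⟨(k, y), hy⟩, rfl, hd⟩

theorem exists_walk_of_center_mem_hypBall (hs : 1 < s)
    (hP : ∀ (k : ℕ) (z : Z), ∃ p ∈ P k, dist z p < s ^ (-(k : ℝ))) (v : HypVert P) (n : ℕ) :
    ∀ x : HypVert P, x.val.1 + n = v.val.1 → v.val.2 ∈ hypBall s x →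
      ∃ p : (hypGraph s P).Walk x v, p.length ≤ n + 1 := by
  have hpos : ∀ k : ℕ, 0 < s ^ (-(k : ℝ)) := fun k => Real.rpow_pos_of_pos (by linarith) _
  induction n with
  | zero =>
    intro x hx hv
    refine exists_walk_length_le_one hv (mem_ball_self (by linarith [hpos v.val.1])) ?_
    rw [abs_le]; omega
  | succ n ih =>
    intro x hx hv
    obtain ⟨y, hy, hd⟩ := exists_hypVert_dist_lt hP (x.val.1 + 1) v.val.2
    have hvy : v.val.2 ∈ hypBall s y := by
      rw [hypBall, mem_ball, hy]
      linarith [hpos (x.val.1 + 1)]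
    obtain ⟨p, hp⟩ := ih y (by omega) hvy
    obtain ⟨q, hq⟩ := exists_walk_length_le_one hv hvy (by rw [abs_le]; omega)
    exact ⟨q.append p, by rw [SimpleGraph.Walk.length_append]; omega⟩

theorem hypGraph_dist_add_le_of_dist_lt (hs : 1 < s)
    (hP : ∀ (k : ℕ) (z : Z), ∃ p ∈ P k, dist z p < s ^ (-(k : ℝ))) {v w : HypVert P} {k : ℕ}
    (hv : k ≤ v.val.1) (hw : k ≤ w.val.1) (h : dist v.val.2 w.val.2 < s⁻¹ ^ k) :
    (hypGraph s P).dist v w + 2 * k ≤ v.val.1 + w.val.1 + 2 := by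
  obtain ⟨y, hy, hd⟩ := exists_hypVert_dist_lt hP k v.val.2
  have hpos : 0 < s ^ (-(k : ℝ)) := Real.rpow_pos_of_pos (by linarith) _
  rw [← rpow_neg_natCast_eq s hs] at h
  obtain ⟨p, hp⟩ := exists_walk_of_center_mem_hypBall hs hP v (v.val.1 - k) y
    (by omega) (by rw [hypBall, mem_ball, hy]; linarith)
  obtain ⟨q, hq⟩ := exists_walk_of_center_mem_hypBall hs hP w (w.val.1 - k) y
    (by omega)
    (by rw [hypBall, mem_ball, hy]; linarith [dist_triangle_left w.val.2 y.val.2 v.val.2])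
  have := SimpleGraph.dist_le (p.reverse.append q)
  rw [SimpleGraph.Walk.length_append, SimpleGraph.Walk.length_reverse] at this
  omega

theorem exists_walk_from_root [CompactSpace Z] (hs : 1 < s)
    (hdiam : diam (Set.univ : Set Z) < 1)
    (hP : ∀ (k : ℕ) (z : Z), ∃ p ∈ P k, dist z p < s ^ (-(k : ℝ)))
    {O : HypVert P} (hO : O.val.1 = 0) (v : HypVert P) :
    ∃ p : (hypGraph s P).Walk O v, p.length ≤ v.val.1 + 1 := by
  refine exists_walk_of_center_mem_hypBall hs hP v v.val.1 O (by omega) ?_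
  rw [hypBall, mem_ball, hO]
  have := dist_le_diam_of_mem (isCompact_univ (X := Z)).isBounded
    (Set.mem_univ v.val.2) (Set.mem_univ O.val.2)
  norm_num
  linarith

end HypGraph

/-- The hyperbolic filling is Gromov hyperbolic: there is `δ ≥ 0`, depending only on `s`,
such that `(u,w) ≥ min((u,v), (v,w)) - δ` for all vertices `u, v, w`, where `(·,·)` is the
Gromov product based at the root vertex `O`. -/
theorem stmt3 (s : ℝ) (hs : 1 < s) :
    ∃ δ : ℝ, 0 ≤ δ ∧
      ∀ (Z : Type) [MetricSpace Z] [CompactSpace Z] [ConnectedSpace Z],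
        0 < diam (Set.univ : Set Z) → diam (Set.univ : Set Z) < 1 →
        ∀ P : ℕ → Set Z,
          (∀ k : ℕ, ∀ p ∈ P k, ∀ q ∈ P k, p ≠ q → s ^ (-(k : ℝ)) ≤ dist p q) →
          (∀ (k : ℕ) (z : Z), ∃ p ∈ P k, dist z p < s ^ (-(k : ℝ))) →
          ∀ O u v w : HypVert P, O.val.1 = 0 →
            min (gromovProd s P O u v) (gromovProd s P O v w) - δ ≤
              gromovProd s P O u w := by
  have h0 : 0 < s := by linarith
  obtain ⟨N, hN⟩ := pow_unbounded_of_one_lt (8 * (1 + s) / (s - 1)) hs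
  refine ⟨N + 3, by positivity, ?_⟩
  intro Z _ _ _ _ hdiam P _ hP O u v w hO
  have hroot := exists_walk_from_root hs hdiam hP hO
  have hconn : (hypGraph s P).Connected :=
    (SimpleGraph.connected_iff_exists_forall_reachable _).2
      ⟨O, fun x => (hroot x).elim fun p _ => ⟨p⟩⟩
  have hlevel (x : HypVert P) : x.val.1 ≤ (hypGraph s P).dist O x ∧
      (hypGraph s P).dist O x ≤ x.val.1 + 1 := by
    obtain ⟨p, hp⟩ := hroot x
    obtain ⟨q, hq⟩ := (hconn O x).exists_walk_length_eq_dist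
    have := hypGraph_level_le_of_walk q
    have := SimpleGraph.dist_le p
    omega
  have hnonneg : 0 ≤ gromovProd s P O u w := by
    have : ((hypGraph s P).dist u w : ℝ) ≤ (hypGraph s P).dist O u + (hypGraph s P).dist O w := by
      rw [SimpleGraph.dist_comm (u := O) (v := u)]
      exact_mod_cast hconn.dist_triangle
    rw [gromovProd]
    linarith
  set G := min (gromovProd s P O u v) (gromovProd s P O v w) with hG
  obtain hG1 | hG1 := lt_or_ge G 1
  · linarith [(Nat.cast_nonneg N : (0 : ℝ) ≤ N)]
  obtain ⟨k, hk, hk'⟩ : ∃ k : ℕ, (k : ℝ) ≤ G - 1 ∧ G - 1 < k + 1 :=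
    ⟨⌊G - 1⌋₊, Nat.floor_le (by linarith), Nat.lt_floor_add_one _⟩
  obtain hkN | hkN := lt_or_ge k N
  · have : (k : ℝ) ≤ N := by exact_mod_cast hkN.le
    linarith
  obtain ⟨j, rfl⟩ := Nat.exists_eq_add_of_le' hkN
  have key {x y : HypVert P} (h : G ≤ gromovProd s P O x y) :
      2 * (j + N) + (hypGraph s P).dist x y ≤ x.val.1 + y.val.1 := by
    rw [gromovProd] at h
    have h1 : (2 * (j + N : ℕ) + (hypGraph s P).dist x y + 2 : ℝ) ≤
      (hypGraph s P).dist O x + (hypGraph s P).dist O y := by linarith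
    have h2 : 2 * (j + N) + (hypGraph s P).dist x y + 2 ≤
      (hypGraph s P).dist O x + (hypGraph s P).dist O y := by exact_mod_cast h1
    have := hlevel x
    have := hlevel y
    omega
  have huv := key (min_le_left _ _ : G ≤ _)
  have hvw := key (min_le_right _ _ : G ≤ _)
  have hduw : dist u.val.2 w.val.2 < s⁻¹ ^ j := by
    have hr : 0 < s⁻¹ ^ (j + N) := by positivity
    calc _ ≤ dist u.val.2 v.val.2 + dist v.val.2 w.val.2 := dist_triangle _ _ _
      _ ≤ 4 * (1 + s) / (s - 1) * s⁻¹ ^ (j + N) + 4 * (1 + s) / (s - 1) * s⁻¹ ^ (j + N) :=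
        add_le_add (dist_center_le_of_two_mul_le hs hconn.preconnected huv)
          (dist_center_le_of_two_mul_le hs hconn.preconnected hvw)
      _ = 8 * (1 + s) / (s - 1) * s⁻¹ ^ (j + N) := by ring
      _ < s ^ N * s⁻¹ ^ (j + N) := by gcongr
      _ ≤ _ := pow_mul_inv_pow_le hs (by omega)
  have hlevel_le {x y : HypVert P} : x.val.1 ≤ y.val.1 + (hypGraph s P).dist x y := by
    obtain ⟨p, hp⟩ := (hconn x y).exists_walk_length_eq_dist
    have := hypGraph_level_le_of_walk p.reverse
    rwa [SimpleGraph.Walk.length_reverse, hp] at this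
  have hu : j ≤ u.val.1 := by
    have := hlevel_le (x := v) (y := u)
    rw [SimpleGraph.dist_comm] at this
    omega
  have hw : j ≤ w.val.1 := by
    have := hlevel_le (x := v) (y := w)
    omega
  have huw := hypGraph_dist_add_le_of_dist_lt hs hP hu hw hduw
  have hfin : ((hypGraph s P).dist u w + 2 * j : ℝ) ≤
      (hypGraph s P).dist O u + (hypGraph s P).dist O w + 2 := by
    have := (hlevel u).1
    have := (hlevel w).1
    exact_mod_cast (by omega : (hypGraph s P).dist u w + 2 * j ≤
      (hypGraph s P).dist O u + (hypGraph s P).dist O w + 2)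
  rw [gromovProd]
  push_cast at hk'
  linarith
end

section
/- Let p > 1 and N ∈ ℕ. There is a constant C = C(p,N) > 0 with the following property: let H and K be countable sets and J ⊆ H × K be such that every set J_h = {k ∈ K : (h,k) ∈ J} and every set J^k = {h ∈ H : (h,k) ∈ J} has at most N elements; let s : H → ℝ and t : K → ℝ satisfy |s(h)| ≤ Σ_{k ∈ J_h} |t(k)| for all h ∈ H; and let b ≥ 0 be such that for all λ > 0 the set {k ∈ K : |t(k)| > λ} is finite with cardinality at most b^p/λ^p. Then for all λ > 0 the set {h ∈ H : |s(h)| > λ} is finite with cardinality at most (C·b)^p/λ^p. -/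
/-- If a finite sum over at most `N` indices exceeds `l > 0`, then some term exceeds
`l / (N + 1)`. -/
theorem exists_div_succ_lt_of_lt_finsum_mem {K : Type*} {A : Set K} (hA : A.Finite) {N : ℕ}
    (hN : A.ncard ≤ N) {f : K → ℝ} {l : ℝ} (hl : 0 < l) (h : l < ∑ᶠ k ∈ A, f k) :
    ∃ k ∈ A, l / (N + 1) < f k := by
  by_contra! hle
  rw [finsum_mem_eq_finite_toFinset_sum f hA] at h
  have hsum := Finset.sum_le_card_nsmul hA.toFinset f (l / (N + 1))
    fun k hk => hle k (hA.mem_toFinset.1 hk)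
  rw [← Set.ncard_eq_toFinset_card A hA, nsmul_eq_mul] at hsum
  have hcard : (A.ncard : ℝ) * (l / (N + 1)) ≤ N * (l / (N + 1)) := by gcongr
  have hlt : (N : ℝ) * (l / (N + 1)) < l := by
    rw [mul_div_assoc', div_lt_iff₀ (by positivity)]
    nlinarith
  linarith

/-- A union over a finite set of finite sets with at most `N` elements each. -/
theorem Set.Finite.ncard_biUnion_le_mul {H K : Type*} {T : Set K} (hT : T.Finite)
    {F : K → Set H} {N : ℕ} (hF : ∀ k, (F k).Finite ∧ (F k).ncard ≤ N) :
    (⋃ k ∈ T, F k).ncard ≤ T.ncard * N := by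
  classical
  have hU : (⋃ k ∈ T, F k) = (hT.toFinset.biUnion fun k => (hF k).1.toFinset : Finset H) := by
    ext; simp
  rw [hU, Set.ncard_coe_finset, Set.ncard_eq_toFinset_card T hT]
  refine Finset.card_biUnion_le_card_mul _ _ _ fun k _ => ?_
  rw [← Set.ncard_eq_toFinset_card (F k) (hF k).1]
  exact (hF k).2

/-- Transfer of a weak `ℓ^p` bound through a correspondence `J ⊆ H × K` whose fibers in
both directions have at most `N` elements: if `|s(h)| ≤ Σ_{k ∈ J_h} |t(k)|` for all `h`
and `t` satisfies a weak `ℓ^p` bound with constant `b`, then `s` satisfies a weak `ℓ^p`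
bound with constant `C·b`, where `C = C(p, N) > 0`. -/
theorem stmt6 (p : ℝ) (hp : 1 < p) (N : ℕ) :
    ∃ C : ℝ, 0 < C ∧
      ∀ (H K : Type) [Countable H] [Countable K] (J : Set (H × K)),
        (∀ h : H, {k : K | (h, k) ∈ J}.Finite ∧ {k : K | (h, k) ∈ J}.ncard ≤ N) →
        (∀ k : K, {h : H | (h, k) ∈ J}.Finite ∧ {h : H | (h, k) ∈ J}.ncard ≤ N) →
        ∀ (s : H → ℝ) (t : K → ℝ),
          (∀ h : H, |s h| ≤ ∑ᶠ k ∈ {k : K | (h, k) ∈ J}, |t k|) →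
          ∀ b : ℝ, 0 ≤ b →
            (∀ l : ℝ, 0 < l → {k : K | |t k| > l}.Finite ∧
              ({k : K | |t k| > l}.ncard : ℝ) ≤ b ^ p / l ^ p) →
            ∀ l : ℝ, 0 < l → {h : H | |s h| > l}.Finite ∧
              ({h : H | |s h| > l}.ncard : ℝ) ≤ (C * b) ^ p / l ^ p := by
  refine ⟨((N : ℝ) + 1) * (N + 1), by positivity, ?_⟩
  intro H K _ _ J hJH hJK s t hst b hb ht l hl
  obtain ⟨hT, hTcard⟩ := ht (l / (N + 1)) (by positivity)
  have hsub : {h : H | |s h| > l} ⊆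
      ⋃ k ∈ {k : K | |t k| > l / (N + 1)}, {h : H | (h, k) ∈ J} := by
    intro h hh
    obtain ⟨k, hk, hlt⟩ := exists_div_succ_lt_of_lt_finsum_mem (hJH h).1 (hJH h).2 hl
      (lt_of_lt_of_le hh (hst h))
    exact Set.mem_biUnion (show k ∈ {k : K | |t k| > l / (N + 1)} from hlt) hk
  have hU := hT.biUnion fun k _ => (hJK k).1
  refine ⟨hU.subset hsub, ?_⟩
  have hcard : ({h : H | |s h| > l}.ncard : ℝ) ≤ {k : K | |t k| > l / (N + 1)}.ncard * N := by
    exact_mod_cast (Set.ncard_le_ncard hsub hU).trans (hT.ncard_biUnion_le_mul hJK)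
  have hNp : (N : ℝ) ≤ ((N : ℝ) + 1) ^ p :=
    (le_add_of_nonneg_right zero_le_one).trans
      (Real.self_le_rpow_of_one_le (by simp) hp.le)
  calc ({h : H | |s h| > l}.ncard : ℝ)
      ≤ {k : K | |t k| > l / (N + 1)}.ncard * N := hcard
    _ ≤ b ^ p / (l / (N + 1)) ^ p * ((N : ℝ) + 1) ^ p := by gcongr
    _ = (((N : ℝ) + 1) * (N + 1) * b) ^ p / l ^ p := by
      rw [Real.div_rpow hl.le (by positivity), Real.mul_rpow (by positivity) hb,
        Real.mul_rpow (by positivity) (by positivity)]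
      field_simp
end

section
/- For every p > 1 there exists a constant S(p) < ∞ with the following property: for every b ≥ 0 and every function f from the set {0,1}^* of finite binary strings to [0,∞) such that for all λ > 0 the set {g ∈ {0,1}^* : f(g) > λ} is finite with cardinality at most b^p/λ^p, there exists an infinite binary sequence ω : ℕ → {0,1} such that Σ_{n=0}^∞ f(ω|_n) ≤ S(p) · b, where ω|_n denotes the initial prefix of ω of length n. -/
/-- The average of `f` over the `2 ^ n` descendants of `g` lying `n` levels below it. -/
noncomputable def descendantAverage (f : List Bool → ℝ) : ℕ → List Bool → ℝ
  | 0, g => f g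
  | n + 1, g => (descendantAverage f n (g ++ [false]) + descendantAverage f n (g ++ [true])) / 2

lemma descendantAverage_nonneg {f : List Bool → ℝ} (hf : ∀ g, 0 ≤ f g) (n : ℕ) (g : List Bool) :
    0 ≤ descendantAverage f n g := by
  induction n generalizing g with
  | zero => exact hf g
  | succ n ih =>
    have h₀ := ih (g ++ [false])
    have h₁ := ih (g ++ [true])
    simp only [descendantAverage]
    positivity

lemma exists_finset_sum_eq_descendantAverage (f : List Bool → ℝ) (n : ℕ) (g : List Bool) :
    ∃ A : Finset (List Bool), A.card = 2 ^ n ∧ (∀ x ∈ A, g <+: x) ∧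
      ∑ x ∈ A, f x = 2 ^ n * descendantAverage f n g := by
  induction n generalizing g with
  | zero => exact ⟨{g}, by simp, by simp, by simp [descendantAverage]⟩
  | succ n ih =>
    obtain ⟨A, hA, hAg, hAs⟩ := ih (g ++ [false])
    obtain ⟨B, hB, hBg, hBs⟩ := ih (g ++ [true])
    have hd : Disjoint A B := by
      rw [Finset.disjoint_left]
      intro x hxA hxB
      obtain ⟨s, rfl⟩ := hAg x hxA
      obtain ⟨t, ht⟩ := hBg _ hxB
      simp at ht
    refine ⟨A ∪ B, ?_, ?_, ?_⟩
    · rw [Finset.card_union_of_disjoint hd, hA, hB]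
      ring
    · intro x hx
      rcases Finset.mem_union.1 hx with h | h
      · exact (List.prefix_append _ _).trans (hAg x h)
      · exact (List.prefix_append _ _).trans (hBg x h)
    · rw [Finset.sum_union hd, hAs, hBs, descendantAverage]
      ring

/-- A function with weak `ℓ^p` bound `b` which is at least `m` on a set of `N` points satisfies
`m ≤ b * N ^ (-1 / p)`. -/
lemma le_of_forall_mem_le_of_weak_bound {α : Type*} {p b m : ℝ} (hp : 0 < p) (hb : 0 ≤ b)
    {f : α → ℝ}
    (h : ∀ l : ℝ, 0 < l → {g : α | f g > l}.Finite ∧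
      ({g : α | f g > l}.ncard : ℝ) ≤ b ^ p / l ^ p)
    {A : Finset α} (hA : A.Nonempty) (hm : ∀ x ∈ A, m ≤ f x) :
    m ≤ b * (A.card : ℝ) ^ (-(1 / p)) := by
  by_contra! hlt
  obtain ⟨l, hl, hlm⟩ := exists_between hlt
  have hN : (0 : ℝ) < A.card := by exact_mod_cast hA.card_pos
  have hl0 : 0 < l := lt_of_le_of_lt (by positivity) hl
  obtain ⟨hfin, hcard⟩ := h l hl0
  have hle : (A.card : ℝ) ≤ ({g : α | f g > l}.ncard : ℝ) := by
    rw [← Set.ncard_coe_finset]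
    exact_mod_cast Set.ncard_le_ncard (fun x hx => hlm.trans_le (hm x hx)) hfin
  have hlp : 0 < l ^ p := Real.rpow_pos_of_pos hl0 p
  have hNl := (le_div_iff₀ hlp).1 (hle.trans hcard)
  have hpow : (b * (A.card : ℝ) ^ (-(1 / p))) ^ p < l ^ p :=
    Real.rpow_lt_rpow (by positivity) hl hp
  rw [Real.mul_rpow hb (by positivity), ← Real.rpow_mul hN.le,
    show -(1 / p) * p = -1 by field_simp, Real.rpow_neg_one, ← div_eq_mul_inv,
    div_lt_iff₀ hN] at hpow
  linarith

lemma rpow_one_sub_add_le {a : ℝ} (ha0 : 0 < a) (ha1 : a < 1) (n : ℕ) :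
    (1 - a)⁻¹ * (n : ℝ) ^ (1 - a) + ((n + 1 : ℕ) : ℝ) ^ (-a) ≤
      (1 - a)⁻¹ * ((n + 1 : ℕ) : ℝ) ^ (1 - a) := by
  have hc : 0 < 1 - a := by linarith
  set x : ℝ := ((n + 1 : ℕ) : ℝ) with hx
  have hx1 : 1 ≤ x := by simp [hx]
  have hx0 : 0 < x := by linarith
  have hn : (n : ℝ) = x * (1 + -x⁻¹) := by
    field_simp
    simp [hx]
  have hinv : x⁻¹ ≤ 1 := inv_le_one_of_one_le₀ hx1
  have hB : (1 + -x⁻¹) ^ (1 - a) ≤ 1 + (1 - a) * -x⁻¹ :=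
    rpow_one_add_le_one_add_mul_self (by linarith) hc.le (by linarith)
  have hxa : x ^ (-a) = x ^ (1 - a) * x⁻¹ := by
    rw [← Real.rpow_neg_one x, ← Real.rpow_add hx0]
    ring_nf
  rw [hn, Real.mul_rpow hx0.le (by linarith), hxa]
  have hxp : 0 < x ^ (1 - a) := Real.rpow_pos_of_pos hx0 _
  calc (1 - a)⁻¹ * (x ^ (1 - a) * (1 + -x⁻¹) ^ (1 - a)) + x ^ (1 - a) * x⁻¹
      ≤ (1 - a)⁻¹ * (x ^ (1 - a) * (1 + (1 - a) * -x⁻¹)) + x ^ (1 - a) * x⁻¹ := by gcongr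
    _ = (1 - a)⁻¹ * x ^ (1 - a) := by
      field_simp
      ring

lemma sum_le_of_weak_bound {α : Type*} {p b : ℝ} (hp : 1 < p) (hb : 0 ≤ b) {f : α → ℝ}
    (h : ∀ l : ℝ, 0 < l → {g : α | f g > l}.Finite ∧
      ({g : α | f g > l}.ncard : ℝ) ≤ b ^ p / l ^ p) (A : Finset α) :
    ∑ x ∈ A, f x ≤ b * ((1 - 1 / p)⁻¹ * (A.card : ℝ) ^ (1 - 1 / p)) := by
  classical
  have ha0 : 0 < 1 / p := by positivity
  have ha1 : 1 / p < 1 := (div_lt_one (by linarith)).2 hp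
  induction hN : A.card generalizing A with
  | zero =>
    rw [Finset.card_eq_zero.1 hN]
    simp [Real.zero_rpow (show 1 - p⁻¹ ≠ 0 by simp at ha1 ⊢; grind)]
  | succ n ih =>
    have hne : A.Nonempty := Finset.card_pos.1 (by omega)
    obtain ⟨x, hx, hmin⟩ := A.exists_min_image f hne
    have h₁ := ih (A.erase x) (by rw [Finset.card_erase_of_mem hx]; omega)
    have h₂ := le_of_forall_mem_le_of_weak_bound (by linarith) hb h hne hmin
    rw [hN] at h₂
    have h₃ := mul_le_mul_of_nonneg_left (rpow_one_sub_add_le ha0 ha1 n) hb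
    rw [← Finset.add_sum_erase A f hx]
    linarith

lemma descendantAverage_le {p b : ℝ} (hp : 1 < p) (hb : 0 ≤ b) {f : List Bool → ℝ}
    (h : ∀ l : ℝ, 0 < l → {g : List Bool | f g > l}.Finite ∧
      ({g : List Bool | f g > l}.ncard : ℝ) ≤ b ^ p / l ^ p) (n : ℕ) (g : List Bool) :
    descendantAverage f n g ≤ b * (1 - 1 / p)⁻¹ * ((2 : ℝ) ^ (-(1 / p))) ^ n := by
  obtain ⟨A, hA, -, hs⟩ := exists_finset_sum_eq_descendantAverage f n g
  have hsum := sum_le_of_weak_bound hp hb h A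
  rw [hs, hA] at hsum
  push_cast at hsum
  have hpow : ((2 : ℝ) ^ n) ^ (1 - 1 / p) = 2 ^ n * ((2 : ℝ) ^ (-(1 / p))) ^ n := by
    rw [sub_eq_add_neg, Real.rpow_add (by positivity), Real.rpow_one,
      ← Real.rpow_natCast, ← Real.rpow_natCast, ← Real.rpow_mul (by norm_num),
      ← Real.rpow_mul (by norm_num), mul_comm (n : ℝ) (-(1 / p))]
  rw [hpow] at hsum
  have h2 : (0 : ℝ) < 2 ^ n := by positivity
  refine le_of_mul_le_mul_left (hsum.trans_eq ?_) h2
  ring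

/-- The prefixes of the ray obtained by always following the child selected by `c`. -/
def greedyPrefix (c : List Bool → Bool) : ℕ → List Bool
  | 0 => []
  | n + 1 => greedyPrefix c n ++ [c (greedyPrefix c n)]

lemma ofFn_greedyPrefix (c : List Bool → Bool) (n : ℕ) :
    (List.ofFn fun i : Fin n => c (greedyPrefix c i)) = greedyPrefix c n := by
  induction n with
  | zero => simp [greedyPrefix]
  | succ n ih =>
    rw [List.ofFn_succ', List.concat_eq_append]
    simpa [greedyPrefix] using ih

/-- A nonnegative potential that dominates `f` plus the average of its values at the two children
yields a ray along which `f` sums to at most the value of the potential at the root. -/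
lemma exists_ray_tsum_le {f F : List Bool → ℝ} (hf : ∀ g, 0 ≤ f g) (hF : ∀ g, 0 ≤ F g)
    (hfF : ∀ g, f g + (F (g ++ [false]) + F (g ++ [true])) / 2 ≤ F g) :
    ∃ ω : ℕ → Bool, Summable (fun n : ℕ => f (List.ofFn fun i : Fin n => ω i)) ∧
      ∑' n : ℕ, f (List.ofFn fun i : Fin n => ω i) ≤ F [] := by
  have hchild : ∀ g, ∃ c : Bool, f g + F (g ++ [c]) ≤ F g := by
    intro g
    have := hfF g
    rcases le_total (F (g ++ [false])) (F (g ++ [true])) with h | h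
    · exact ⟨false, by linarith⟩
    · exact ⟨true, by linarith⟩
  choose c hc using hchild
  have hpart : ∀ n, ∑ k ∈ Finset.range n, f (greedyPrefix c k) + F (greedyPrefix c n) ≤ F [] := by
    intro n
    induction n with
    | zero => simp [greedyPrefix]
    | succ n ih =>
      have := hc (greedyPrefix c n)
      rw [Finset.sum_range_succ, greedyPrefix]
      linarith
  have hle : ∀ n, ∑ k ∈ Finset.range n, f (greedyPrefix c k) ≤ F [] := fun n => by
    linarith [hpart n, hF (greedyPrefix c n)]
  refine ⟨fun n => c (greedyPrefix c n), ?_⟩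
  simp only [ofFn_greedyPrefix]
  exact ⟨summable_of_sum_range_le (fun n => hf _) hle,
    Real.tsum_le_of_sum_range_le (fun n => hf _) hle⟩


/-- For every `p > 1` there is `S(p) < ∞` such that: whenever `f` on the infinite rooted
binary tree (finite binary strings) satisfies a weak `ℓ^p` bound with constant `b`, there
is an infinite binary sequence `ω` whose prefixes `ω|_n` satisfy
`Σ_{n=0}^∞ f(ω|_n) ≤ S(p) · b`. -/
theorem stmt14 (p : ℝ) (hp : 1 < p) :
    ∃ S : ℝ, ∀ b : ℝ, 0 ≤ b → ∀ f : List Bool → ℝ, (∀ g, 0 ≤ f g) →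
      (∀ l : ℝ, 0 < l → {g : List Bool | f g > l}.Finite ∧
        ({g : List Bool | f g > l}.ncard : ℝ) ≤ b ^ p / l ^ p) →
      ∃ ω : ℕ → Bool,
        Summable (fun n : ℕ => f (List.ofFn fun i : Fin n => ω i)) ∧
          ∑' n : ℕ, f (List.ofFn fun i : Fin n => ω i) ≤ S * b := by
  refine ⟨(1 - 1 / p)⁻¹ * (1 - (2 : ℝ) ^ (-(1 / p)))⁻¹, fun b hb f hf h => ?_⟩
  have hr0 : (0 : ℝ) ≤ 2 ^ (-(1 / p)) := by positivity
  have hr1 : (2 : ℝ) ^ (-(1 / p)) < 1 :=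
    Real.rpow_lt_one_of_one_lt_of_neg (by norm_num) (neg_lt_zero.2 (by positivity))
  have hgeom := (summable_geometric_of_lt_one hr0 hr1).mul_left (b * (1 - 1 / p)⁻¹)
  have hsum : ∀ g, Summable fun n => descendantAverage f n g := fun g =>
    hgeom.of_nonneg_of_le (fun n => descendantAverage_nonneg hf n g)
      (fun n => descendantAverage_le hp hb h n g)
  obtain ⟨ω, hω, hle⟩ := exists_ray_tsum_le (F := fun g => ∑' n, descendantAverage f n g) hf
    (fun g => tsum_nonneg fun n => descendantAverage_nonneg hf n g) (fun g => by
      rw [(hsum g).tsum_eq_zero_add]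
      simp only [descendantAverage]
      rw [tsum_div_const, (hsum _).tsum_add (hsum _)])
  refine ⟨ω, hω, hle.trans ?_⟩
  calc ∑' n, descendantAverage f n []
      ≤ ∑' n : ℕ, b * (1 - 1 / p)⁻¹ * ((2 : ℝ) ^ (-(1 / p))) ^ n :=
        (hsum []).tsum_le_tsum (fun n => descendantAverage_le hp hb h n []) hgeom
    _ = (1 - 1 / p)⁻¹ * (1 - (2 : ℝ) ^ (-(1 / p)))⁻¹ * b := by
      rw [tsum_mul_left, tsum_geometric_of_lt_one hr0 hr1]
      ring
end
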